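/- arXiv:1207.1802 — 3 statements merged into one kernel-verified Lean document; each statement's English description precedes it below -/
import Mathlib

section
/- Let T be a tree with adjacent vertices u and v of degrees 1 and 2 respectively, and let T' = T - {u, v}. Then the number of eigenvalues of T' lying in the open interval (-1, 1) is at most the number of eigenvalues of T lying in (-1, 1), counted with multiplicity. -/
open scoped Classical

/-- Characteristic polynomial of the adjacency matrix of a graph. -/
noncomputable def gCharpoly {V : Type*} [Fintype V] (G : SimpleGraph V) : Polynomial ℝ :=
  letI := Classical.decEq V
  letI := Classical.decRel G.Adj
  (G.adjMatrix ℝ).charpoly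

/-- Adjacency eigenvalues listed in non-increasing order (with multiplicity). -/
noncomputable def eigsDesc {V : Type*} [Fintype V] (G : SimpleGraph V) : List ℝ :=
  ((gCharpoly G).roots.sort (· ≤ ·)).reverse

/-- Number of adjacency eigenvalues in the open interval (-1, 1), with multiplicity. -/
noncomputable def numIn {V : Type*} [Fintype V] (G : SimpleGraph V) : ℕ :=
  ((gCharpoly G).roots.filter (fun x => -1 < x ∧ x < 1)).card

/-- Multiplicity of `lam` as an adjacency eigenvalue. -/
noncomputable def multOf {V : Type*} [Fintype V] (G : SimpleGraph V) (lam : ℝ) : ℕ :=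
  (gCharpoly G).roots.count lam

/-- Nullity: dimension of the kernel of the adjacency matrix. -/
noncomputable def gNullity {V : Type*} [Fintype V] (G : SimpleGraph V) : ℕ :=
  letI := Classical.decRel G.Adj
  Module.finrank ℝ (LinearMap.ker (G.adjMatrix ℝ).mulVecLin)

open Matrix in
theorem aux_spec {V : Type*} [Fintype V] (G : SimpleGraph V) :
    ∃ (d : V → ℝ) (e : (V → ℝ) ≃ₗ[ℝ] (V → ℝ)),
      (∀ x, ∑ i, x i ^ 2 = ∑ i, (e x i) ^ 2) ∧
      (∀ x, ∑ i, ((G.adjMatrix ℝ) *ᵥ x) i ^ 2 = ∑ i, d i ^ 2 * (e x i) ^ 2) ∧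
      numIn G = Fintype.card {i // -1 < d i ∧ d i < 1} := by
  have hA : (G.adjMatrix ℝ).IsHermitian := by
    rw [Matrix.IsHermitian, Matrix.conjTranspose_eq_transpose_of_trivial]
    exact G.isSymm_adjMatrix
  let b := hA.eigenvectorBasis
  let e : (V → ℝ) ≃ₗ[ℝ] (V → ℝ) :=
    (WithLp.linearEquiv 2 ℝ (V → ℝ)).symm ≪≫ₗ b.repr.toLinearEquiv ≪≫ₗ WithLp.linearEquiv 2 ℝ (V → ℝ)
  have he : ∀ x, ∑ i, x i ^ 2 = ∑ i, (e x i) ^ 2 := by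
    intro x
    have h := b.repr.norm_map (WithLp.toLp 2 x)
    have h2 : ‖b.repr (WithLp.toLp 2 x)‖ ^ 2 = ‖WithLp.toLp 2 x‖ ^ 2 := by rw [h]
    rw [EuclideanSpace.real_norm_sq_eq, EuclideanSpace.real_norm_sq_eq] at h2
    exact h2.symm
  refine ⟨hA.eigenvalues, e, he, ?_, ?_⟩
  · intro x
    rw [he]
    refine Finset.sum_congr rfl fun i _ => ?_
    have h1 : ∀ y : V → ℝ, e y i = (b i).ofLp ⬝ᵥ y := by
      intro y
      change b.repr (WithLp.toLp 2 y) i = _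
      rw [b.repr_apply_apply, EuclideanSpace.inner_eq_star_dotProduct]
      simp [dotProduct_comm]
    rw [h1, h1, Matrix.dotProduct_mulVec, ← Matrix.mulVec_transpose, G.isSymm_adjMatrix.eq]
    have h3 := hA.mulVec_eigenvectorBasis i
    change _ *ᵥ (b i).ofLp = _ at h3
    rw [h3]
    change (_ • (b i).ofLp ⬝ᵥ x) ^ 2 = _
    rw [smul_dotProduct, smul_eq_mul, mul_pow]
  · have h : gCharpoly G = (G.adjMatrix ℝ).charpoly := by
      unfold gCharpoly
      congr!
    unfold numIn
    rw [h, hA.roots_charpoly_eq_eigenvalues, Multiset.filter_map, Multiset.card_map,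
      Fintype.card_subtype]
    rfl

open Matrix in
theorem aux_main {V W : Type*} [Fintype V] [Fintype W] (G : SimpleGraph V) (H : SimpleGraph W)
    (L : (W → ℝ) →ₗ[ℝ] (V → ℝ))
    (h1 : ∀ x, ∑ i, x i ^ 2 ≤ ∑ i, (L x i) ^ 2)
    (h2 : ∀ x, ∑ i, ((G.adjMatrix ℝ) *ᵥ (L x)) i ^ 2 ≤ ∑ i, ((H.adjMatrix ℝ) *ᵥ x) i ^ 2) :
    numIn H ≤ numIn G := by
  obtain ⟨d, e, he, hd, hn⟩ := aux_spec G
  obtain ⟨d', e', he', hd', hn'⟩ := aux_spec H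
  rw [hn, hn']
  let E : ({i // -1 < d' i ∧ d' i < 1} → ℝ) →ₗ[ℝ] (W → ℝ) :=
    Function.ExtendByZero.linearMap ℝ Subtype.val
  let g : ({i // -1 < d' i ∧ d' i < 1} → ℝ) →ₗ[ℝ] ({i // -1 < d i ∧ d i < 1} → ℝ) :=
    LinearMap.funLeft ℝ ℝ Subtype.val ∘ₗ e.toLinearMap ∘ₗ L ∘ₗ e'.symm.toLinearMap ∘ₗ E
  have hg : Function.Injective g := by
    rw [← LinearMap.ker_eq_bot, LinearMap.ker_eq_bot']
    intro c hc
    have hE : ∀ i, E c i.1 = c i := fun i =>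
      Function.Injective.extend_apply Subtype.val_injective _ _ _
    have hE0 : ∀ i, ¬ (-1 < d' i ∧ d' i < 1) → E c i = 0 := fun i hi =>
      Function.extend_apply' _ _ _ (by rintro ⟨a, rfl⟩; exact hi a.2)
    set x := e'.symm (E c) with hx
    have hex : e' x = E c := by simp [hx]
    have hz : ∀ i, (-1 < d i ∧ d i < 1) → e (L x) i = 0 := fun i hi => congrFun hc ⟨i, hi⟩
    have a1 : ∑ i, (e (L x) i) ^ 2 ≤ ∑ i, d i ^ 2 * (e (L x) i) ^ 2 := by
      refine Finset.sum_le_sum fun i _ => ?_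
      by_cases hi : -1 < d i ∧ d i < 1
      · simp [hz i hi]
      · have : 1 ≤ d i ^ 2 := by
          by_contra hlt
          exact hi (abs_lt.mp (by rw [← sq_lt_one_iff_abs_lt_one]; linarith))
        nlinarith [sq_nonneg (e (L x) i)]
    have a2 : ∑ i, (e' x i) ^ 2 ≤ ∑ i, d' i ^ 2 * (e' x i) ^ 2 := by
      rw [← he', ← hd']
      rw [← he, ← hd] at a1
      exact (h1 x).trans (a1.trans (h2 x))
    rw [hex] at a2
    have a3 : ∀ i, 0 ≤ (E c i) ^ 2 - d' i ^ 2 * (E c i) ^ 2 := by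
      intro i
      by_cases hi : -1 < d' i ∧ d' i < 1
      · have : d' i ^ 2 < 1 := by rw [sq_lt_one_iff_abs_lt_one]; exact abs_lt.mpr hi
        nlinarith [sq_nonneg (E c i)]
      · simp [hE0 i hi]
    have a4 : ∑ i, ((E c i) ^ 2 - d' i ^ 2 * (E c i) ^ 2) = 0 := by
      apply le_antisymm
      · rw [Finset.sum_sub_distrib]; linarith
      · exact Finset.sum_nonneg fun i _ => a3 i
    rw [Finset.sum_eq_zero_iff_of_nonneg fun i _ => a3 i] at a4
    funext i
    have h5 := a4 i.1 (Finset.mem_univ _)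
    have : d' i.1 ^ 2 < 1 := by rw [sq_lt_one_iff_abs_lt_one]; exact abs_lt.mpr i.2
    rw [hE] at h5
    have h6 : (1 - d' i.1 ^ 2) * c i ^ 2 = 0 := by linarith
    rcases mul_eq_zero.mp h6 with h | h
    · linarith
    · simpa using h
  simpa using LinearMap.finrank_le_finrank_of_injective hg

theorem stmt5 {V : Type*} [Fintype V] (T : SimpleGraph V) (hT : T.IsTree) (u v : V)
    (huv : T.Adj u v)
    (hdu : (T.neighborSet u).ncard = 1) (hdv : (T.neighborSet v).ncard = 2) :
    numIn (T.induce {w | w ≠ u ∧ w ≠ v}) ≤ numIn T := by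
  have hu : ∀ w, T.Adj u w ↔ w = v := by
    obtain ⟨a, ha⟩ := Set.ncard_eq_one.mp hdu
    have hv : v ∈ T.neighborSet u := huv
    intro w
    rw [← SimpleGraph.mem_neighborSet]
    rw [ha] at hv ⊢
    simp only [Set.mem_singleton_iff] at hv ⊢
    rw [hv]
  have huv' : u ≠ v := huv.ne
  let E : ({w | w ≠ u ∧ w ≠ v} → ℝ) →ₗ[ℝ] (V → ℝ) :=
    Function.ExtendByZero.linearMap ℝ Subtype.val
  let s : (V → ℝ) →ₗ[ℝ] ℝ := LinearMap.proj v ∘ₗ (T.adjMatrix ℝ).mulVecLin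
  let L : ({w | w ≠ u ∧ w ≠ v} → ℝ) →ₗ[ℝ] (V → ℝ) :=
    E - (LinearMap.single ℝ (fun _ : V => ℝ) u) ∘ₗ s ∘ₗ E
  have hE : ∀ c i, E c i.1 = c i := fun c i =>
    Function.Injective.extend_apply Subtype.val_injective _ _ _
  have hE0 : ∀ c i, ¬ (i ≠ u ∧ i ≠ v) → E c i = 0 := fun c i hi =>
    Function.extend_apply' _ _ _ (by rintro ⟨a, rfl⟩; exact hi a.2)
  have hL : ∀ c, L c = E c - Pi.single u (s (E c)) := fun c => rfl
  have hsum : ∀ f : V → ℝ, ∑ i, f i = f u + f v + ∑ i : {w | w ≠ u ∧ w ≠ v}, f i := by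
    intro f
    rw [← Finset.sum_subtype (Finset.univ.filter fun w => w ≠ u ∧ w ≠ v) (by simp) f,
      ← Finset.sum_filter_add_sum_filter_not Finset.univ (fun w => w ≠ u ∧ w ≠ v), add_comm,
      ← Finset.sum_pair huv']
    congr 1
    refine Finset.sum_congr ?_ fun _ _ => rfl
    ext w
    simp only [Finset.mem_filter, Finset.mem_univ, true_and, Finset.mem_insert,
      Finset.mem_singleton]
    tauto
  apply aux_main T _ L
  · intro x
    rw [hsum]
    have : ∀ i : {w | w ≠ u ∧ w ≠ v}, L x i = x i := by
      intro i
      rw [hL, Pi.sub_apply, hE, Pi.single_eq_of_ne i.2.1, sub_zero]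
    simp only [this]
    nlinarith [sq_nonneg (L x u), sq_nonneg (L x v)]
  · intro x
    rw [hsum]
    have hA : ∀ j, ((T.adjMatrix ℝ).mulVec (L x)) j =
        ((T.adjMatrix ℝ).mulVec (E x)) j - T.adjMatrix ℝ j u * s (E x) := by
      intro j
      rw [hL, Matrix.mulVec_sub, Pi.sub_apply, Matrix.mulVec_single]
      simp [mul_comm]
    have h1 : ((T.adjMatrix ℝ).mulVec (L x)) v = 0 := by
      rw [hA]
      simp [SimpleGraph.adjMatrix_apply, huv.symm, s]
    have h2 : ((T.adjMatrix ℝ).mulVec (L x)) u = 0 := by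
      rw [hA]
      simp only [Matrix.mulVec, dotProduct, SimpleGraph.adjMatrix_apply, hu]
      simp [hE0, huv']
    have h3 : ∀ i : {w | w ≠ u ∧ w ≠ v}, ((T.adjMatrix ℝ).mulVec (L x)) i =
        (((T.induce {w | w ≠ u ∧ w ≠ v}).adjMatrix ℝ).mulVec x) i := by
      intro i
      have : ¬ T.Adj i.1 u := by rw [T.adj_comm, hu]; exact i.2.2
      rw [hA, SimpleGraph.adjMatrix_apply, if_neg this, zero_mul, sub_zero]
      simp only [Matrix.mulVec, dotProduct]
      rw [hsum, hE0 x u (by simp), hE0 x v (by simp)]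
      simp only [mul_zero, zero_add, hE]
      refine Finset.sum_congr rfl fun j _ => ?_
      simp [SimpleGraph.adjMatrix_apply]
    rw [h1, h2]
    rw [zero_pow two_ne_zero, add_zero, zero_add]
    refine le_of_eq (Finset.sum_congr rfl fun i _ => ?_)
    rw [h3]
    congr!
end

section
/- For every nonnegative integer k, there are only finitely many reduced trees (up to isomorphism) having exactly k adjacency eigenvalues in the open interval (-1, 1). -/
open scoped Classical

/-- There is a pendant `P₂` at `v`: the graph minus `v` has a connected component
isomorphic to `P₂`, consisting of adjacent vertices `a, b` all of whose other
neighbors are `v`. -/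
def HasPendantP2At {V : Type*} (G : SimpleGraph V) (v : V) : Prop :=
  ∃ a b : V, a ≠ v ∧ b ≠ v ∧ G.Adj a b ∧
    (∀ w, G.Adj a w → w = b ∨ w = v) ∧ (∀ w, G.Adj b w → w = a ∨ w = v)

/-- A graph is reduced if it has no pendant `P₂` at any vertex. -/
def Reduced {V : Type*} (G : SimpleGraph V) : Prop :=
  ∀ v : V, ¬ HasPendantP2At G v


/-- The adjacency operator. -/
noncomputable def adjOp {V : Type*} [Fintype V] (G : SimpleGraph V) : (V → ℝ) →ₗ[ℝ] (V → ℝ) :=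
  (G.adjMatrix ℝ).mulVecLin

lemma numIn_ge_of_map {V : Type*} [Fintype V] (G : SimpleGraph V)
    {U : Type*} [AddCommGroup U] [Module ℝ U] (φ : U →ₗ[ℝ] (V → ℝ))
    (h : ∀ u, u ≠ 0 → adjOp G (φ u) ⬝ᵥ adjOp G (φ u) < φ u ⬝ᵥ φ u) :
    Module.finrank ℝ U ≤ numIn G := by
  have hA : (G.adjMatrix ℝ).IsHermitian := by
    rw [Matrix.IsHermitian, Matrix.conjTranspose_eq_transpose_of_trivial]
    exact G.transpose_adjMatrix
  set A := G.adjMatrix ℝ with hAdef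
  let b := hA.eigenvectorBasis
  let lam := hA.eigenvalues
  have hnum : numIn G = Fintype.card {j : V // -1 < lam j ∧ lam j < 1} := by
    have h1 : gCharpoly G = A.charpoly := by
      unfold gCharpoly
      congr!
    rw [numIn, h1, hA.roots_charpoly_eq_eigenvalues, Multiset.filter_map, Multiset.card_map,
      Fintype.card_subtype]
    rfl
  rw [hnum]
  have hdot : ∀ x : V → ℝ, x ⬝ᵥ x = ∑ j, (b j ⬝ᵥ x) ^ 2 := by
    intro x
    have := b.sum_sq_norm_inner_right (WithLp.toLp 2 x)
    rw [EuclideanSpace.real_norm_sq_eq] at this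
    simp only [dotProduct, ← sq]
    simp only [Real.norm_eq_abs, sq_abs] at this
    rw [← this]
    apply Finset.sum_congr rfl
    intro j _
    rw [EuclideanSpace.inner_eq_star_dotProduct]
    simp [dotProduct, mul_comm]
  have hAx : ∀ (x : V → ℝ) j, b j ⬝ᵥ adjOp G x = lam j * (b j ⬝ᵥ x) := by
    intro x j
    have h2 := hA.mulVec_eigenvectorBasis j
    have : adjOp G x = A.mulVec x := rfl
    rw [this, Matrix.dotProduct_mulVec, ← Matrix.mulVec_transpose]
    have h3 : A.transpose = A := G.transpose_adjMatrix
    rw [h3]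
    change (A.mulVec (hA.eigenvectorBasis j)) ⬝ᵥ x = _
    rw [h2, smul_dotProduct, smul_eq_mul]
  let Φ : U →ₗ[ℝ] ({j : V // -1 < lam j ∧ lam j < 1} → ℝ) :=
    { toFun := fun u j => b j ⬝ᵥ φ u
      map_add' := by intro u v; ext j; simp [dotProduct_add]
      map_smul' := by intro c u; ext j; simp [dotProduct_smul] }
  have hinj : Function.Injective Φ := by
    rw [injective_iff_map_eq_zero]
    intro u hu
    by_contra hne
    have := h u hne
    rw [hdot, hdot (φ u)] at this
    apply absurd this
    rw [not_lt]
    apply Finset.sum_le_sum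
    intro j _
    rw [hAx]
    by_cases hj : -1 < lam j ∧ lam j < 1
    · have : b j ⬝ᵥ φ u = 0 := congrFun hu ⟨j, hj⟩
      simp [this]
    · rw [mul_pow]
      have : 1 ≤ lam j ^ 2 := by
        by_contra hlt
        apply hj
        rw [← abs_lt]
        rw [not_le] at hlt
        exact (sq_lt_one_iff_abs_lt_one _).1 hlt
      nlinarith [sq_nonneg (b j ⬝ᵥ φ u)]
  have := LinearMap.finrank_le_finrank_of_injective hinj
  simpa using this

lemma numIn_ge_of_family {V : Type*} [Fintype V] (G : SimpleGraph V)
    {ι : Type*} [Fintype ι] (x : ι → V → ℝ)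
    (h : ∀ i, adjOp G (x i) ⬝ᵥ adjOp G (x i) < x i ⬝ᵥ x i)
    (ho : ∀ i j, i ≠ j → x i ⬝ᵥ x j = 0)
    (hoA : ∀ i j, i ≠ j → adjOp G (x i) ⬝ᵥ adjOp G (x j) = 0) :
    Fintype.card ι ≤ numIn G := by
  have key : ∀ (y : ι → V → ℝ) (_ : ∀ i j, i ≠ j → y i ⬝ᵥ y j = 0) (c : ι → ℝ),
      (∑ i, c i • y i) ⬝ᵥ (∑ i, c i • y i) = ∑ i, c i ^ 2 * (y i ⬝ᵥ y i) := by
    intro y hy c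
    rw [sum_dotProduct]
    apply Finset.sum_congr rfl
    intro i _
    rw [dotProduct_sum, Finset.sum_eq_single i]
    · simp [smul_dotProduct, dotProduct_smul]; ring
    · intro j _ hj
      simp [smul_dotProduct, dotProduct_smul, hy i j hj.symm]
    · simp
  have := numIn_ge_of_map G (Fintype.linearCombination ℝ x) (by
    intro u hu
    rw [Fintype.linearCombination_apply, map_sum]
    simp only [map_smul]
    rw [key _ hoA, key _ ho]
    obtain ⟨i, hi⟩ := Function.ne_iff.1 hu
    apply Finset.sum_lt_sum
    · intro i _
      exact mul_le_mul_of_nonneg_left (h i).le (sq_nonneg _)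
    · refine ⟨i, Finset.mem_univ _, ?_⟩
      have hi' : u i ≠ 0 := hi
      exact mul_lt_mul_of_pos_left (h i) (by positivity))
  simpa using this

/-- A rooting of a tree: root, parent function, depth. -/
structure Rooting {V : Type*} (G : SimpleGraph V) where
  r : V
  p : V → V
  dep : V → ℕ
  pr : p r = r
  depr : dep r = 0
  depp : ∀ v, v ≠ r → dep v = dep (p v) + 1
  adj : ∀ u v, G.Adj u v ↔ (v ≠ r ∧ p v = u) ∨ (u ≠ r ∧ p u = v)

lemma exists_rooting {V : Type*} (G : SimpleGraph V) (hG : G.IsTree) : Nonempty (Rooting G) := by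
  obtain ⟨r⟩ := hG.connected.nonempty
  have h1 : ∀ v, ∃ u, (v = r → u = r) ∧ (v ≠ r → G.Adj v u ∧ G.dist r v = G.dist r u + 1) ∧
      ∀ u', G.Adj v u' → G.dist r v = G.dist r u' + 1 → u' = u := by
    intro v
    by_cases hv : v = r
    · subst hv
      exact ⟨v, by simp, by simp, by simp⟩
    · obtain ⟨q, hq, hql⟩ := hG.connected.exists_path_of_dist v r
      have hpos : 0 < G.dist v r := hG.connected.pos_dist_of_ne hv
      cases q with
      | nil => exact absurd rfl hv
      | @cons _ u _ hadj q' =>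
        refine ⟨u, by simp [hv], fun _ => ⟨hadj, ?_⟩, ?_⟩
        · have h2 := hG.dist_eq_dist_add_one_of_adj r hadj
          have h3 := G.dist_le q'
          rw [SimpleGraph.Walk.length_cons] at hql
          rw [G.dist_comm] at hql h3
          omega
        · intro u' hu' hd
          obtain ⟨q2, hq2, hq2l⟩ := hG.connected.exists_path_of_dist u' r
          have h4 : (SimpleGraph.Walk.cons hu' q2).IsPath := by
            apply SimpleGraph.Walk.isPath_of_length_eq_dist
            rw [SimpleGraph.Walk.length_cons, hq2l, G.dist_comm, ← hd, G.dist_comm]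
          have := (hG.existsUnique_path v r).unique h4 hq
          have h5 := congrArg SimpleGraph.Walk.snd this
          simpa using h5
  choose p hp using h1
  refine ⟨⟨r, p, G.dist r, (hp r).1 rfl, by simp, fun v hv => ((hp v).2.1 hv).2, ?_⟩⟩
  intro u v
  constructor
  · intro h
    rcases hG.dist_eq_dist_add_one_of_adj r h with h2 | h2
    · right
      refine ⟨?_, ((hp u).2.2 v h h2).symm⟩
      rintro rfl
      simp at h2
    · left
      refine ⟨?_, ((hp v).2.2 u h.symm h2).symm⟩
      rintro rfl
      simp at h2
  · rintro (⟨h, rfl⟩ | ⟨h, rfl⟩)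
    · exact ((hp v).2.1 h).1.symm
    · exact ((hp u).2.1 h).1


section LocalVectors
variable {V : Type*} [Fintype V] {G : SimpleGraph V}

/-- Standard basis vector. -/
noncomputable def ev (v : V) : V → ℝ := Pi.single v 1

lemma ev_apply (v u : V) : ev v u = if u = v then 1 else 0 := by
  simp [ev, Pi.single_apply]

lemma ev_dot (v u : V) : ev v ⬝ᵥ ev u = if v = u then 1 else 0 := by
  simp [ev, Pi.single_apply, eq_comm]

lemma adjOp_ev (v u : V) : adjOp G (ev v) u = if G.Adj v u then 1 else 0 := by
  simp [adjOp, ev, G.adj_comm]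

lemma dot_eq_zero_of_disjoint (x y : V → ℝ) (h : ∀ v, x v ≠ 0 → y v ≠ 0 → False) :
    x ⬝ᵥ y = 0 := by
  apply Finset.sum_eq_zero
  intro v _
  by_contra hne
  exact h v (left_ne_zero_of_mul hne) (right_ne_zero_of_mul hne)

lemma local_block (dep : V → ℕ) (w : ℕ → V) (D : ℕ) (hw : ∀ i ≤ 8, dep (w i) + i = D)
    (hgood : ∀ i ≤ 6, (adjOp G (ev (w (i+1))) = ev (w i) + ev (w (i+2))) ∨
      ∃ l, l ≠ w i ∧ dep l + i = D ∧
        adjOp G (ev (w (i+1))) = ev (w i) + ev (w (i+2)) + ev l ∧ adjOp G (ev l) = ev (w (i+1))) :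
    ∃ x : V → ℝ, adjOp G x ⬝ᵥ adjOp G x < x ⬝ᵥ x ∧
      (∀ v, x v ≠ 0 → D ≤ dep v + 8 ∧ dep v ≤ D) ∧
      (∀ v, adjOp G x v ≠ 0 → D ≤ dep v + 8 ∧ dep v ≤ D) := by
  by_cases h01 : ∃ i ≤ 5, adjOp G (ev (w (i+1))) = ev (w i) + ev (w (i+2)) ∧
      ∃ l, l ≠ w (i+1) ∧ dep l + (i+1) = D ∧ adjOp G (ev l) = ev (w (i+2))
  · obtain ⟨i, hi, h0, l, hl, hdl, hAl⟩ := h01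
    have hA : adjOp G (ev (w (i+1)) - ev l) = ev (w i) := by
      rw [map_sub, h0, hAl]; abel
    have h1 := hw i (by omega)
    have h2 := hw (i+1) (by omega)
    refine ⟨ev (w (i+1)) - ev l, ?_, ?_, ?_⟩
    · rw [hA]
      simp [dotProduct_sub, sub_dotProduct, ev_dot, hl, hl.symm]
    · intro v hv
      by_cases e1 : v = w (i+1)
      · subst e1; omega
      by_cases e2 : v = l
      · subst e2; omega
      simp [ev_apply, e1, e2] at hv
    · intro v hv
      rw [hA] at hv
      by_cases e1 : v = w i
      · subst e1; omega
      simp [ev_apply, e1] at hv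
  by_cases h10 : ∃ i ≤ 5, adjOp G (ev (w (i+2))) = ev (w (i+1)) + ev (w (i+3)) ∧
      ∃ l, dep l + i = D ∧ adjOp G (ev l) = ev (w (i+1))
  · obtain ⟨i, hi, h0, l, hdl, hAl⟩ := h10
    have hA : adjOp G (ev (w (i+2)) - ev l) = ev (w (i+3)) := by
      rw [map_sub, h0, hAl]; abel
    have h1 := hw (i+2) (by omega)
    have h2 := hw (i+3) (by omega)
    have hl : l ≠ w (i+2) := by rintro rfl; omega
    refine ⟨ev (w (i+2)) - ev l, ?_, ?_, ?_⟩
    · rw [hA]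
      simp [dotProduct_sub, sub_dotProduct, ev_dot, hl, hl.symm]
    · intro v hv
      by_cases e1 : v = w (i+2)
      · subst e1; omega
      by_cases e2 : v = l
      · subst e2; omega
      simp [ev_apply, e1, e2] at hv
    · intro v hv
      rw [hA] at hv
      by_cases e1 : v = w (i+3)
      · subst e1; omega
      simp [ev_apply, e1] at hv
  have step0 : ∀ i ≤ 5, adjOp G (ev (w (i+1))) = ev (w i) + ev (w (i+2)) →
      adjOp G (ev (w (i+2))) = ev (w (i+1)) + ev (w (i+3)) := by
    intro i hi h0
    rcases hgood (i+1) (by omega) with h | ⟨l, a, b, c, d⟩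
    · exact h
    · exact absurd ⟨i, hi, h0, l, a, b, d⟩ h01
  have h0 := hw 0 (by omega)
  have h1 := hw 1 (by omega)
  have h2 := hw 2 (by omega)
  have h3 := hw 3 (by omega)
  have h4 := hw 4 (by omega)
  have h6 := hw 6 (by omega)
  have h7 := hw 7 (by omega)
  rcases hgood 0 (by omega) with g0 | ⟨l1, l1w, l1d, -, l1A⟩
  · have g1 := step0 0 (by omega) g0
    have g2 := step0 1 (by omega) g1
    have g3 := step0 2 (by omega) g2
    have g4 := step0 3 (by omega) g3
    have g5 := step0 4 (by omega) g4
    simp only [Nat.reduceAdd, zero_add] at g1 g3 g5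
    have hA : adjOp G (ev (w 2) - ev (w 4) + ev (w 6)) = ev (w 1) + ev (w 7) := by
      rw [map_add, map_sub, g1, g3, g5]; abel
    have n1 : w 2 ≠ w 4 := fun h => by rw [h] at h2; omega
    have n2 : w 2 ≠ w 6 := fun h => by rw [h] at h2; omega
    have n3 : w 4 ≠ w 6 := fun h => by rw [h] at h4; omega
    have n4 : w 1 ≠ w 7 := fun h => by rw [h] at h1; omega
    refine ⟨ev (w 2) - ev (w 4) + ev (w 6), ?_, ?_, ?_⟩
    rotate_left
    · intro v hv
      by_cases e1 : v = w 2
      · subst e1; omega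
      by_cases e2 : v = w 4
      · subst e2; omega
      by_cases e3 : v = w 6
      · subst e3; omega
      exact absurd (by simp [ev_apply, e1, e2, e3] : (ev (w 2) - ev (w 4) + ev (w 6)) v = 0) hv
    · intro v hv
      rw [hA] at hv
      by_cases e1 : v = w 1
      · subst e1; omega
      by_cases e2 : v = w 7
      · subst e2; omega
      simp [ev_apply, e1, e2] at hv
    · rw [hA]
      simp [dotProduct_sub, sub_dotProduct, dotProduct_add, add_dotProduct, ev_dot, n1, n2, n3, n4,
        n1.symm, n2.symm, n3.symm, n4.symm]
  · rcases hgood 1 (by omega) with g1 | ⟨l2, l2w, l2d, l2B, l2A⟩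
    · exact absurd ⟨0, by omega, g1, l1, l1d, l1A⟩ h10
    rcases hgood 2 (by omega) with g2 | ⟨l3, l3w, l3d, l3B, l3A⟩
    · exact absurd ⟨1, by omega, g2, l2, l2d, l2A⟩ h10
    simp only [Nat.reduceAdd, zero_add] at l1A l2B l3A
    have hA : adjOp G (ev (w 2) - ev l1 - ev l3) = ev l2 := by
      rw [map_sub, map_sub, l2B, l1A, l3A]; abel
    have n1 : w 2 ≠ l1 := fun h => by rw [h] at h2; omega
    have n2 : w 2 ≠ l3 := l3w.symm
    have n3 : l1 ≠ l3 := fun h => by rw [h] at l1d; omega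
    refine ⟨ev (w 2) - ev l1 - ev l3, ?_, ?_, ?_⟩
    rotate_left
    · intro v hv
      by_cases e1 : v = w 2
      · subst e1; omega
      by_cases e2 : v = l1
      · subst e2; omega
      by_cases e3 : v = l3
      · subst e3; omega
      exact absurd (by simp [ev_apply, e1, e2, e3] : (ev (w 2) - ev l1 - ev l3) v = 0) hv
    · intro v hv
      rw [hA] at hv
      by_cases e1 : v = l2
      · subst e1; omega
      simp [ev_apply, e1] at hv
    · rw [hA]
      simp [dotProduct_sub, sub_dotProduct, ev_dot, n1, n2, n3,
        n1.symm, n2.symm, n3.symm]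

end LocalVectors

namespace Rooting
variable {V : Type*} {G : SimpleGraph V} (R : Rooting G)

def leaf (v : V) : Prop := v ≠ R.r ∧ ∀ c, c ≠ R.r → R.p c ≠ v

lemma dep_eq_zero {v : V} (h : R.dep v = 0) : v = R.r := by
  by_contra hv
  have := R.depp v hv
  omega

lemma dep_p (v : V) : R.dep (R.p v) = R.dep v - 1 := by
  by_cases hv : v = R.r
  · subst hv; rw [R.pr, R.depr]
  · have := R.depp v hv
    omega

lemma dep_iter (i : ℕ) (v : V) : R.dep (R.p^[i] v) = R.dep v - i := by
  induction i with
  | zero => simp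
  | succ i ih => rw [Function.iterate_succ_apply', dep_p, ih]; omega

lemma ne_r_of_dep {v : V} (h : 0 < R.dep v) : v ≠ R.r := by
  rintro rfl
  rw [R.depr] at h
  omega

lemma adj_leaf {v : V} (hv : R.leaf v) (u : V) : G.Adj v u ↔ u = R.p v := by
  rw [R.adj]
  constructor
  · rintro (⟨h1, h2⟩ | ⟨h1, h2⟩)
    · exact absurd h2 (hv.2 u h1)
    · exact h2.symm
  · rintro rfl
    exact Or.inr ⟨hv.1, rfl⟩

/-- Vertices with at least two leaf children. -/
def twin (v : V) : Prop := ∃ a b, a ≠ b ∧ R.leaf a ∧ R.leaf b ∧ R.p a = v ∧ R.p b = v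

lemma exists_twin_below [Finite V] (hred : Reduced G) {v : V} (hv : ¬ R.leaf v) (hr : v ≠ R.r) :
    ∃ y, R.twin y ∧ ∃ i, R.p^[i] y = v := by
  obtain ⟨u, ⟨hu1, hu2, i, hi⟩, hmax⟩ := Set.exists_max_image
    {u | ¬ R.leaf u ∧ u ≠ R.r ∧ ∃ i, R.p^[i] u = v} R.dep (Set.toFinite _) ⟨v, hv, hr, 0, rfl⟩
  refine ⟨u, ?_, i, hi⟩
  have hch : ∀ c, c ≠ R.r → R.p c = u → R.leaf c := by
    intro c hc hcu
    by_contra hl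
    have h1 := hmax c ⟨hl, hc, i + 1, by rw [Function.iterate_succ_apply, hcu, hi]⟩
    have h2 := R.depp c hc
    rw [hcu] at h2
    omega
  have : ∃ c, c ≠ R.r ∧ R.p c = u := by
    by_contra hno
    push Not at hno
    exact hu1 ⟨hu2, hno⟩
  obtain ⟨c, hc, hcu⟩ := this
  by_contra hnt
  have huniq : ∀ c', c' ≠ R.r → R.p c' = u → c' = c := by
    intro c' hc' hcu'
    by_contra hne
    exact hnt ⟨c', c, hne, hch _ hc' hcu', hch _ hc hcu, hcu', hcu⟩
  apply hred (R.p u)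
  have d1 := R.depp u hu2
  have d2 := R.depp c hc
  rw [hcu] at d2
  refine ⟨u, c, ?_, ?_, ?_, ?_, ?_⟩
  · intro h; rw [← h] at d1; omega
  · intro h; rw [h] at d2; omega
  · rw [R.adj]; exact Or.inl ⟨hc, hcu⟩
  · intro w hw
    rw [R.adj] at hw
    rcases hw with ⟨h1, h2⟩ | ⟨h1, h2⟩
    · exact Or.inl (huniq w h1 h2)
    · exact Or.inr h2.symm
  · intro w hw
    rw [R.adj_leaf (hch c hc hcu)] at hw
    left; rw [hw, hcu]

variable [Fintype V]

lemma card_le_nonleaf :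
    Fintype.card V ≤ numIn G + 2 * Fintype.card {v // ¬ R.leaf v} := by
  let π : (V → ℝ) →ₗ[ℝ] ({v // ¬ R.leaf v} → ℝ) := LinearMap.funLeft ℝ ℝ Subtype.val
  let L : (V → ℝ) →ₗ[ℝ] (({v // ¬ R.leaf v} → ℝ) × ({v // ¬ R.leaf v} → ℝ)) :=
    π.prod (π ∘ₗ adjOp G)
  have h1 := numIn_ge_of_map G (LinearMap.ker L).subtype (by
    rintro ⟨x, hx⟩ hne
    have hx0 : x ≠ 0 := fun h => hne (by simp [h])
    have hx1 : π x = 0 := congrArg Prod.fst hx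
    have hx2 : π (adjOp G x) = 0 := congrArg Prod.snd hx
    have hA : adjOp G x = 0 := by
      ext v
      by_cases hv : R.leaf v
      · have : adjOp G x v = ∑ u ∈ G.neighborFinset v, x u := by
          simp [adjOp, SimpleGraph.adjMatrix_mulVec_apply]
        rw [this]
        apply Finset.sum_eq_zero
        intro u hu
        rw [SimpleGraph.mem_neighborFinset, R.adj_leaf hv] at hu
        have hnl : ¬ R.leaf u := fun h => h.2 v hv.1 hu.symm
        exact congrFun hx1 ⟨u, hnl⟩
      · exact congrFun hx2 ⟨v, hv⟩
    simp only [Submodule.subtype_apply, hA, zero_dotProduct]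
    have h0 : 0 ≤ x ⬝ᵥ x := Finset.sum_nonneg fun i _ => mul_self_nonneg _
    exact lt_of_le_of_ne h0 fun h => hx0 (dotProduct_self_eq_zero.1 h.symm))
  have h2 := LinearMap.finrank_range_add_finrank_ker L
  have h3 := Submodule.finrank_le (LinearMap.range L)
  simp only [Module.finrank_prod, Module.finrank_pi] at h2 h3
  omega

lemma card_twin_le : Fintype.card {v // R.twin v} ≤ numIn G := by
  choose a b hab la lb pa pb using fun v : {v // R.twin v} => v.2
  have hA : ∀ v, adjOp G (ev (a v) - ev (b v)) = 0 := by
    intro v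
    ext u
    rw [map_sub, Pi.sub_apply, adjOp_ev, adjOp_ev, R.adj_leaf (la v), R.adj_leaf (lb v), pa, pb]
    simp
  refine numIn_ge_of_family G (fun v => ev (a v) - ev (b v)) ?_ ?_ ?_
  · intro v
    simp only [hA]
    simp [dotProduct_sub, sub_dotProduct, ev_dot, hab v, (hab v).symm]
  · intro u v huv
    have huv' : u.1 ≠ v.1 := fun h => huv (Subtype.ext h)
    have n1 : a u ≠ a v := fun h => huv' (by rw [← pa, ← pa, h])
    have n2 : a u ≠ b v := fun h => huv' (by rw [← pa, ← pb, h])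
    have n3 : b u ≠ a v := fun h => huv' (by rw [← pb, ← pa, h])
    have n4 : b u ≠ b v := fun h => huv' (by rw [← pb, ← pb, h])
    simp [dotProduct_sub, sub_dotProduct, ev_dot, n1, n2, n3, n4]
  · intro u v _
    simp only [hA]
    simp

/-- Twin vertices below the `i`-th ancestor of `z`. -/
noncomputable def below (z : V) (i : ℕ) : Finset V :=
  Finset.univ.filter fun y => R.twin y ∧ ∃ j, R.p^[j] y = R.p^[i] z

lemma below_succ (z : V) (i : ℕ) : R.below z i ⊆ R.below z (i + 1) := by
  intro y hy
  simp only [below, Finset.mem_filter, Finset.mem_univ, true_and] at hy ⊢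
  obtain ⟨h, j, hj⟩ := hy
  exact ⟨h, j + 1, by rw [Function.iterate_succ_apply', hj, Function.iterate_succ_apply']⟩

lemma below_mono (z : V) : Monotone (R.below z) := monotone_nat_of_le_succ (R.below_succ z)

lemma good_step (hred : Reduced G) (z : V) (i : ℕ) (hi : i + 1 < R.dep z)
    (hf : R.below z (i + 1) ⊆ R.below z i) :
    (adjOp G (ev (R.p^[i+1] z)) = ev (R.p^[i] z) + ev (R.p^[i+2] z)) ∨
      ∃ l, l ≠ R.p^[i] z ∧ R.dep l + i = R.dep z ∧
        adjOp G (ev (R.p^[i+1] z)) = ev (R.p^[i] z) + ev (R.p^[i+2] z) + ev l ∧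
        adjOp G (ev l) = ev (R.p^[i+1] z) := by
  have d0 := R.dep_iter i z
  have d1 := R.dep_iter (i+1) z
  have d2 := R.dep_iter (i+2) z
  have e1 : R.p (R.p^[i] z) = R.p^[i+1] z := (Function.iterate_succ_apply' _ _ _).symm
  have e2 : R.p (R.p^[i+1] z) = R.p^[i+2] z := (Function.iterate_succ_apply' _ _ _).symm
  generalize R.p^[i+2] z = w2 at *
  have hb : ∀ y, R.twin y → (∃ j, R.p^[j] y = R.p^[i+1] z) → ∃ j, R.p^[j] y = R.p^[i] z := by
    intro y h1 h2
    have := @hf y (by simp only [below, Finset.mem_filter, Finset.mem_univ, true_and]; exact ⟨h1, h2⟩)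
    simp only [below, Finset.mem_filter, Finset.mem_univ, true_and] at this
    exact this.2
  generalize R.p^[i+1] z = w1 at *
  generalize R.p^[i] z = w0 at *
  have r0 : w0 ≠ R.r := R.ne_r_of_dep (by omega)
  have r1 : w1 ≠ R.r := R.ne_r_of_dep (by omega)
  have hleaf : ∀ c, c ≠ R.r → R.p c = w1 → c ≠ w0 → R.leaf c := by
    intro c hc hcw hne
    by_contra hl
    obtain ⟨y, hy, a, ha⟩ := R.exists_twin_below hred hl hc
    obtain ⟨b, hb'⟩ := hb y hy ⟨a + 1, by rw [Function.iterate_succ_apply', ha, hcw]⟩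
    have f1 := R.dep_iter a y
    have f2 := R.dep_iter b y
    have f3 := R.depp c hc
    rw [ha] at f1
    rw [hb'] at f2
    rw [hcw] at f3
    have : a = b := by omega
    subst this
    exact hne (ha.symm.trans hb')
  have huniq : ∀ c c', c ≠ R.r → R.p c = w1 → c ≠ w0 → c' ≠ R.r → R.p c' = w1 → c' ≠ w0 →
      c = c' := by
    intro c c' h1 h2 h3 h1' h2' h3'
    by_contra hne
    obtain ⟨j, hj⟩ := hb w1 ⟨c, c', hne, hleaf c h1 h2 h3, hleaf c' h1' h2' h3', h2, h2'⟩ ⟨0, rfl⟩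
    have f1 := R.dep_iter j w1
    rw [hj] at f1
    omega
  have n02 : w0 ≠ w2 := by rintro rfl; omega
  by_cases hex : ∃ c, c ≠ R.r ∧ R.p c = w1 ∧ c ≠ w0
  · right
    obtain ⟨c, h1, h2, h3⟩ := hex
    have hd := R.depp c h1
    rw [h2] at hd
    have n2 : c ≠ w2 := by rintro rfl; omega
    refine ⟨c, h3, by omega, ?_, ?_⟩
    · ext u
      rw [adjOp_ev]
      have hadj : G.Adj w1 u ↔ u = w0 ∨ u = w2 ∨ u = c := by
        rw [R.adj]
        constructor
        · rintro (⟨a, b⟩ | ⟨a, b⟩)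
          · by_cases hu : u = w0
            · exact Or.inl hu
            · exact Or.inr (Or.inr (huniq u c a b hu h1 h2 h3))
          · exact Or.inr (Or.inl (b.symm.trans e2))
        · rintro (rfl | rfl | rfl)
          · exact Or.inl ⟨r0, e1⟩
          · exact Or.inr ⟨r1, e2⟩
          · exact Or.inl ⟨h1, h2⟩
      simp only [hadj, Pi.add_apply, ev_apply]
      by_cases u0 : u = w0
      · subst u0; simp [n02, h3.symm]
      by_cases u2 : u = w2
      · subst u2; simp [n02.symm, n2.symm]
      simp [u0, u2]
    · ext u
      rw [adjOp_ev, R.adj_leaf (hleaf c h1 h2 h3), h2, ev_apply]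
  · left
    ext u
    rw [adjOp_ev]
    have hadj : G.Adj w1 u ↔ u = w0 ∨ u = w2 := by
      rw [R.adj]
      constructor
      · rintro (⟨a, b⟩ | ⟨a, b⟩)
        · by_cases hu : u = w0
          · exact Or.inl hu
          · exact absurd ⟨u, a, b, hu⟩ hex
        · exact Or.inr (b.symm.trans e2)
      · rintro (rfl | rfl)
        · exact Or.inl ⟨r0, e1⟩
        · exact Or.inr ⟨r1, e2⟩
    simp only [hadj, Pi.add_apply, ev_apply]
    by_cases u0 : u = w0
    · subst u0; simp [n02]
    simp [u0]

lemma bad_count (z : V) (M : ℕ) :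
    ((Finset.range M).filter fun b => ¬ R.below z (9*b+8) ⊆ R.below z (9*b)).card
      ≤ (R.below z (9*M)).card := by
  induction M with
  | zero => simp
  | succ M ih =>
    rw [Finset.range_add_one, Finset.filter_insert]
    by_cases h : R.below z (9*M+8) ⊆ R.below z (9*M)
    · rw [if_neg (not_not.2 h)]
      exact ih.trans (Finset.card_le_card (R.below_mono z (by omega : 9*M ≤ 9*(M+1))))
    · rw [if_pos h, Finset.card_insert_of_notMem (by simp)]
      have h1 : R.below z (9*M) ⊂ R.below z (9*M+8) :=
        ⟨R.below_mono z (by omega), h⟩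
      have h2 := Finset.card_lt_card h1
      have h3 := Finset.card_le_card (R.below_mono z (by omega : 9*M+8 ≤ 9*(M+1)))
      omega

lemma good_count (hred : Reduced G) (z : V) :
    ((Finset.range (R.dep z / 9)).filter fun b => R.below z (9*b+8) ⊆ R.below z (9*b)).card
      ≤ numIn G := by
  set S := (Finset.range (R.dep z / 9)).filter fun b => R.below z (9*b+8) ⊆ R.below z (9*b) with hS
  have hb : ∀ b : S, 9 * b.1 + 9 ≤ R.dep z ∧ R.below z (9*b.1+8) ⊆ R.below z (9*b.1) := by
    rintro ⟨b, hb⟩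
    rw [hS, Finset.mem_filter, Finset.mem_range] at hb
    refine ⟨?_, hb.2⟩
    have := hb.1
    dsimp only
    omega
  have hx := fun b : S => local_block (G := G) R.dep (fun i => R.p^[9*b.1+i] z) (R.dep z - 9*b.1)
    (by
      intro i hi
      have := (hb b).1
      rw [R.dep_iter]; omega)
    (by
      intro i hi
      have h1 := (hb b).1
      rcases R.good_step hred z (9*b.1+i) (by omega)
        ((R.below_mono z (by omega)).trans ((hb b).2.trans (R.below_mono z (by omega)))) with
          h | ⟨l, a1, a2, a3, a4⟩
      · exact Or.inl h
      · exact Or.inr ⟨l, a1, by omega, a3, a4⟩)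
  choose x hx1 hx2 hx3 using hx
  have hdisj : ∀ (b c : S), b ≠ c → ∀ v, (R.dep z - 9*b.1 ≤ R.dep v + 8 ∧ R.dep v ≤ R.dep z - 9*b.1) →
      (R.dep z - 9*c.1 ≤ R.dep v + 8 ∧ R.dep v ≤ R.dep z - 9*c.1) → False := by
    intro b c hbc v h1 h2
    have h3 := (hb b).1
    have h4 := (hb c).1
    apply hbc
    apply Subtype.ext
    omega
  have := numIn_ge_of_family G x hx1
    (fun b c hbc => dot_eq_zero_of_disjoint _ _ fun v h1 h2 =>
      hdisj b c hbc v (hx2 b v h1) (hx2 c v h2))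
    (fun b c hbc => dot_eq_zero_of_disjoint _ _ fun v h1 h2 =>
      hdisj b c hbc v (hx3 b v h1) (hx3 c v h2))
  simpa using this

lemma dep_lt (hred : Reduced G) (z : V) : R.dep z < 9 * (2 * numIn G + 1) := by
  have h1 := R.good_count hred z
  have h2 := R.bad_count z (R.dep z / 9)
  have h3 : (R.below z (9 * (R.dep z / 9))).card ≤ Fintype.card {v // R.twin v} := by
    rw [Fintype.card_subtype]
    apply Finset.card_le_card
    intro y hy
    simp only [below, Finset.mem_filter, Finset.mem_univ, true_and] at hy ⊢
    exact hy.1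
  have h4 := R.card_twin_le
  have h5 := Finset.card_filter_add_card_filter_not (s := Finset.range (R.dep z / 9))
    (fun b => R.below z (9*b+8) ⊆ R.below z (9*b))
  rw [Finset.card_range] at h5
  omega

lemma nonleaf_le (hred : Reduced G) :
    Fintype.card {v // ¬ R.leaf v} ≤ 1 + numIn G * (9 * (2 * numIn G + 1)) := by
  have hsub : (Finset.univ.filter fun v => ¬ R.leaf v) ⊆
      {R.r} ∪ (Finset.univ.filter fun v => R.twin v).biUnion fun z =>
        (Finset.range (9 * (2 * numIn G + 1))).image fun i => R.p^[i] z := by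
    intro v hv
    simp only [Finset.mem_filter, Finset.mem_univ, true_and] at hv
    by_cases hr : v = R.r
    · simp [hr]
    · obtain ⟨y, hy, i, hi⟩ := R.exists_twin_below hred hv hr
      apply Finset.mem_union_right
      rw [Finset.mem_biUnion]
      refine ⟨y, by simpa using hy, ?_⟩
      rw [Finset.mem_image]
      refine ⟨i, ?_, hi⟩
      rw [Finset.mem_range]
      have h1 := R.dep_iter i y
      have h2 := R.depp v hr
      have h3 := R.dep_lt hred y
      rw [hi] at h1
      omega
  rw [Fintype.card_subtype]
  refine (Finset.card_le_card hsub).trans ((Finset.card_union_le _ _).trans ?_)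
  rw [Finset.card_singleton]
  apply Nat.add_le_add_left
  refine (Finset.card_biUnion_le_card_mul _ _ (9 * (2 * numIn G + 1)) ?_).trans ?_
  · intro z _
    exact Finset.card_image_le.trans (by simp)
  · apply Nat.mul_le_mul_right
    rw [← Fintype.card_subtype]
    exact R.card_twin_le

end Rooting

theorem stmt8 (k : ℕ) :
    {n : ℕ | ∃ G : SimpleGraph (Fin n), G.IsTree ∧ Reduced G ∧ numIn G = k}.Finite := by
  apply (Set.finite_Iic (k + 2 * (1 + k * (9 * (2 * k + 1))))).subset
  rintro n ⟨G, hT, hred, hk⟩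
  obtain ⟨R⟩ := exists_rooting G hT
  have h1 := R.card_le_nonleaf
  have h2 := R.nonleaf_le hred
  rw [hk] at h1 h2
  rw [Fintype.card_fin] at h1
  rw [Set.mem_Iic]
  omega
end

section
/- Let n ≥ 2 and r_1, ..., r_n nonnegative integers, let T = C(r_1, ..., r_n) be the caterpillar on the path P_{2n+1} with r_i pendant vertices at v_{2i}, and let s ≥ t be the two largest values among r_1, ..., r_n. Then s + 2 < λ_1(T)^2 < s + 4 and λ_2(T)^2 ≥ t. -/
open scoped Classical

/-- Base relation for the caterpillar `C(r₁, …, rₙ)`: the path `P_{2n+1}` on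
`Fin (2*n+1)` (vertex `vⱼ` of the paper is index `j-1`), with `r i` pendant
vertices attached to `v_{2(i+1)}`, i.e. to index `2*i+1`. -/
def catRel (n : ℕ) (r : Fin n → ℕ) :
    (Fin (2 * n + 1) ⊕ (Σ i : Fin n, Fin (r i))) →
    (Fin (2 * n + 1) ⊕ (Σ i : Fin n, Fin (r i))) → Prop :=
  fun x y =>
    match x, y with
    | Sum.inl a, Sum.inl b => (a : ℕ) + 1 = (b : ℕ)
    | Sum.inl a, Sum.inr p => (a : ℕ) = 2 * (p.1 : ℕ) + 1
    | _, _ => False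

/-- The caterpillar tree `C(r₁, …, rₙ)`. -/
def caterpillar (n : ℕ) (r : Fin n → ℕ) :
    SimpleGraph (Fin (2 * n + 1) ⊕ (Σ i : Fin n, Fin (r i))) :=
  SimpleGraph.fromRel (catRel n r)

/-- Base relation for `S(r₁, …, rₙ)`: the caterpillar `C(r₁, …, rₙ)`, together with
one new pendant vertex at each vertex `v₁, v₃, …, v_{2n+1}` (the odd-indexed path
vertices, i.e. indices `0, 2, …, 2n`, which include the two degree-one path endpoints),
and one new pendant vertex at each pendant vertex of the caterpillar. -/
def sRel (n : ℕ) (r : Fin n → ℕ) :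
    ((Fin (2 * n + 1) ⊕ (Σ i : Fin n, Fin (r i))) ⊕ (Fin (n + 1) ⊕ (Σ i : Fin n, Fin (r i)))) →
    ((Fin (2 * n + 1) ⊕ (Σ i : Fin n, Fin (r i))) ⊕ (Fin (n + 1) ⊕ (Σ i : Fin n, Fin (r i)))) →
    Prop :=
  fun x y =>
    match x, y with
    | Sum.inl a, Sum.inl b => catRel n r a b
    | Sum.inl (Sum.inl a), Sum.inr (Sum.inl k) => (a : ℕ) = 2 * (k : ℕ)
    | Sum.inl (Sum.inr p), Sum.inr (Sum.inr q) => p = q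
    | _, _ => False

/-- The tree `S(r₁, …, rₙ)`. -/
def sTree (n : ℕ) (r : Fin n → ℕ) :
    SimpleGraph ((Fin (2 * n + 1) ⊕ (Σ i : Fin n, Fin (r i))) ⊕
      (Fin (n + 1) ⊕ (Σ i : Fin n, Fin (r i)))) :=
  SimpleGraph.fromRel (sRel n r)

lemma eigsDesc_eq {V : Type*} [Fintype V] (G : SimpleGraph V)
    (hA : (G.adjMatrix ℝ).IsHermitian) :
    eigsDesc G = List.ofFn hA.eigenvalues₀ := by
  have h1 : gCharpoly G = (G.adjMatrix ℝ).charpoly := by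
    unfold gCharpoly
    congr!
  rw [eigsDesc, h1, hA.roots_charpoly_eq_eigenvalues₀]
  rw [List.reverse_eq_iff]
  have hp : ((List.ofFn hA.eigenvalues₀).reverse).Pairwise (· ≤ ·) := by
    rw [List.pairwise_reverse]
    exact hA.eigenvalues₀_antitone.sortedGE_ofFn.pairwise
  refine List.Perm.eq_of_pairwise (le := (· ≤ ·)) ?_ (Multiset.pairwise_sort _ _) hp ?_
  · intro a b _ _ h1 h2
    exact le_antisymm h1 h2
  · rw [← Multiset.coe_eq_coe, Multiset.sort_eq, Fin.univ_val_map]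
    rw [Multiset.coe_eq_coe]
    exact (List.reverse_perm _).symm

lemma spec {V : Type*} [Fintype V] (G : SimpleGraph V) (h2 : 2 ≤ Fintype.card V) :
    ∃ u : V → ℝ, u ≠ 0 ∧
      (∀ v, ∑ w, (if G.Adj v w then u w else 0) = (eigsDesc G).getD 0 0 * u v) ∧
      (∀ x : V → ℝ, ∑ v, x v * ∑ w, (if G.Adj v w then x w else 0) ≤
        (eigsDesc G).getD 0 0 * ∑ v, x v ^ 2) ∧
      (∀ x : V → ℝ, ∑ v, u v * x v = 0 →
        ∑ v, x v * ∑ w, (if G.Adj v w then x w else 0) ≤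
        (eigsDesc G).getD 1 0 * ∑ v, x v ^ 2) := by
  have hA : (G.adjMatrix ℝ).IsHermitian := by
    have := G.isSymm_adjMatrix (α := ℝ)
    rw [Matrix.IsHermitian, Matrix.conjTranspose_eq_transpose_of_trivial]
    exact this
  have e := eigsDesc_eq G hA
  set f : Fin (Fintype.card V) ≃ V := Fintype.equivOfCardEq (Fintype.card_fin _) with hf
  have hval : ∀ k, hA.eigenvalues (f k) = hA.eigenvalues₀ k := by
    intro k
    simp only [Matrix.IsHermitian.eigenvalues, ← hf, Equiv.symm_apply_apply]
  have hanti := hA.eigenvalues₀_antitone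
  have e0 : (eigsDesc G).getD 0 0 = hA.eigenvalues₀ ⟨0, by omega⟩ := by
    rw [e, List.getD_eq_getElem _ _ (by simp; omega)]; simp
  have e1 : (eigsDesc G).getD 1 0 = hA.eigenvalues₀ ⟨1, by omega⟩ := by
    rw [e, List.getD_eq_getElem _ _ (by simp; omega)]; simp
  set b := hA.eigenvectorBasis with hb
  have hmv : ∀ (x : V → ℝ) v, ∑ w, (if G.Adj v w then x w else 0) = ((G.adjMatrix ℝ).mulVec x) v := by
    intro x v
    simp [Matrix.mulVec, dotProduct, SimpleGraph.adjMatrix_apply]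
  have heig : ∀ (k v), ((G.adjMatrix ℝ).mulVec (b k)) v = hA.eigenvalues k * b k v := by
    intro k v
    have := congrFun (hA.mulVec_eigenvectorBasis k) v
    simpa using this
  -- coordinates
  have hnorm : ∀ x : V → ℝ, ∑ v, x v ^ 2 = ∑ k, (∑ v, b k v * x v) ^ 2 := by
    intro x
    have := b.sum_inner_mul_inner (WithLp.toLp 2 x) (WithLp.toLp 2 x)
    simp only [PiLp.inner_apply, RCLike.inner_apply, conj_trivial] at this
    rw [show ∑ v, x v ^ 2 = ∑ v, x v * x v by simp [sq], ← this]
    refine Finset.sum_congr rfl fun k _ => ?_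
    rw [sq]
    congr 1
    refine Finset.sum_congr rfl fun v _ => mul_comm _ _
  have hquad : ∀ x : V → ℝ, ∑ v, x v * ((G.adjMatrix ℝ).mulVec x) v
      = ∑ k, hA.eigenvalues k * (∑ v, b k v * x v) ^ 2 := by
    intro x
    have := b.sum_inner_mul_inner (WithLp.toLp 2 x) (WithLp.toLp 2 ((G.adjMatrix ℝ).mulVec x))
    simp only [PiLp.inner_apply, RCLike.inner_apply, conj_trivial] at this
    rw [show ∑ v, x v * ((G.adjMatrix ℝ).mulVec x) v
      = ∑ v, ((G.adjMatrix ℝ).mulVec x) v * x v by simp [mul_comm], ← this]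
    refine Finset.sum_congr rfl fun k _ => ?_
    have h3 : ∑ v, ((G.adjMatrix ℝ).mulVec x) v * b k v
        = hA.eigenvalues k * ∑ v, b k v * x v := by
      have : (G.adjMatrix ℝ).mulVec x ⬝ᵥ (b k) = x ⬝ᵥ ((G.adjMatrix ℝ).mulVec (b k)) := by
        rw [Matrix.dotProduct_mulVec, ← Matrix.mulVec_transpose, G.isSymm_adjMatrix.eq]
      simp only [dotProduct, heig] at this
      rw [this, Finset.mul_sum]
      refine Finset.sum_congr rfl fun v _ => by ring
    rw [h3]
    ring
  refine ⟨b (f ⟨0, by omega⟩), ?_, ?_, ?_, ?_⟩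
  · intro h
    apply b.orthonormal.ne_zero (f ⟨0, by omega⟩)
    ext v
    exact congrFun h v
  · intro v
    rw [hmv, heig, e0, hval]
  · intro x
    simp only [hmv]
    rw [hquad, hnorm, Finset.mul_sum]
    refine Finset.sum_le_sum fun k _ => ?_
    refine mul_le_mul_of_nonneg_right ?_ (sq_nonneg _)
    obtain ⟨k, rfl⟩ := f.surjective k
    rw [hval, e0]
    exact hanti (Fin.mk_le_of_le_val (Nat.zero_le _))
  · intro x hx
    simp only [hmv]
    rw [hquad, hnorm, Finset.mul_sum]
    refine Finset.sum_le_sum fun k _ => ?_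
    obtain ⟨k, rfl⟩ := f.surjective k
    by_cases hk : k = ⟨0, by omega⟩
    · rw [hk, hx]; simp
    refine mul_le_mul_of_nonneg_right ?_ (sq_nonneg _)
    rw [hval, e1]
    refine hanti (Fin.mk_le_of_le_val ?_)
    have : k.val ≠ 0 := fun h => hk (Fin.ext h)
    omega

lemma cat_adj {n : ℕ} {r : Fin n → ℕ} (x y) :
    (caterpillar n r).Adj x y ↔ (catRel n r x y ∨ catRel n r y x) := by
  unfold caterpillar
  rw [SimpleGraph.fromRel_adj]
  constructor
  · exact fun h => h.2
  · intro h
    refine ⟨?_, h⟩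
    rintro rfl
    rcases x with a | p <;> simp [catRel] at h

/-- Extension by zero of the path part of a vector. -/
noncomputable def ext0 {n : ℕ} {r : Fin n → ℕ}
    (u : (Fin (2 * n + 1) ⊕ (Σ i : Fin n, Fin (r i))) → ℝ) (m : ℕ) : ℝ :=
  if h : m < 2 * n + 1 then u (Sum.inl ⟨m, h⟩) else 0

lemma sum_fin_eq {N : ℕ} (g : Fin N → ℝ) (m : ℕ) :
    ∑ b : Fin N, (if (b : ℕ) = m then g b else 0) = if h : m < N then g ⟨m, h⟩ else 0 := by
  split_ifs with h
  · rw [Finset.sum_eq_single ⟨m, h⟩]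
    · simp
    · intro b _ hb
      rw [if_neg]
      intro h'
      exact hb (Fin.ext h')
    · simp
  · refine Finset.sum_eq_zero fun b _ => ?_
    rw [if_neg]
    have := b.2
    omega

lemma cat_sum_inr {n : ℕ} {r : Fin n → ℕ}
    (u : (Fin (2 * n + 1) ⊕ (Σ i : Fin n, Fin (r i))) → ℝ) (k : Fin n) (p : Fin (r k)) :
    ∑ w, (if (caterpillar n r).Adj (Sum.inr ⟨k, p⟩) w then u w else 0)
      = ext0 u (2 * k + 1) := by
  rw [Fintype.sum_sum_type]
  simp only [cat_adj, catRel, or_false, false_or, if_false, Finset.sum_const_zero, add_zero]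
  rw [sum_fin_eq]
  rfl

lemma cat_sum_inl {n : ℕ} {r : Fin n → ℕ}
    (u : (Fin (2 * n + 1) ⊕ (Σ i : Fin n, Fin (r i))) → ℝ) (a : ℕ) (ha : a < 2 * n + 1) :
    ∑ w, (if (caterpillar n r).Adj (Sum.inl ⟨a, ha⟩) w then u w else 0)
      = ext0 u (a + 1) + (if a = 0 then 0 else ext0 u (a - 1))
        + ∑ k : Fin n, if a = 2 * (k : ℕ) + 1 then ∑ p : Fin (r k), u (Sum.inr ⟨k, p⟩) else 0 := by
  rw [Fintype.sum_sum_type]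
  simp only [cat_adj, catRel, or_false]
  congr 1
  · have : ∀ b : Fin (2 * n + 1), (if a + 1 = (b : ℕ) ∨ (b : ℕ) + 1 = a then u (Sum.inl b) else 0)
      = (if (b : ℕ) = a + 1 then u (Sum.inl b) else 0)
        + (if a = 0 then 0 else if (b : ℕ) = a - 1 then u (Sum.inl b) else 0) := by
      intro b
      split_ifs <;> first | omega | simp
    rw [Finset.sum_congr rfl fun b _ => this b, Finset.sum_add_distrib, sum_fin_eq]
    congr 1
    split_ifs with h
    · simp
    · rw [sum_fin_eq]; rfl
  · rw [Fintype.sum_sigma]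
    refine Finset.sum_congr rfl fun k _ => ?_
    split_ifs <;> simp

lemma upper {n : ℕ} (hn : 2 ≤ n) {r : Fin n → ℕ} {s : ℕ} (hmax : ∀ k, r k ≤ s)
    (u : (Fin (2 * n + 1) ⊕ (Σ i : Fin n, Fin (r i))) → ℝ) (hu : u ≠ 0) (l : ℝ)
    (h : ∀ v, ∑ w, (if (caterpillar n r).Adj v w then u w else 0) = l * u v) :
    l ^ 2 < (s : ℝ) + 4 := by
  by_cases hl : l = 0
  · rw [hl, zero_pow two_ne_zero]; positivity
  have hr : ∀ (k : Fin n) p, l * u (Sum.inr ⟨k, p⟩) = ext0 u (2 * k + 1) := by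
    intro k p
    rw [← h, cat_sum_inr]
  have hev : ∀ k, k ≤ n → l * ext0 u (2 * k) = ext0 u (2 * k + 1)
      + (if k = 0 then 0 else ext0 u (2 * k - 1)) := by
    intro k hk
    have h1 := h (Sum.inl ⟨2 * k, by omega⟩)
    rw [cat_sum_inl] at h1
    have : ext0 u (2 * k) = u (Sum.inl ⟨2 * k, by omega⟩) := dif_pos _
    rw [this, ← h1, Finset.sum_eq_zero, add_zero]
    · congr 1
      simp
    · intro m _
      rw [if_neg]
      omega
  have hod : ∀ k (hk : k < n), l * ext0 u (2 * k + 1) = ext0 u (2 * k + 2) + ext0 u (2 * k)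
      + ∑ p : Fin (r ⟨k, hk⟩), u (Sum.inr ⟨⟨k, hk⟩, p⟩) := by
    intro k hk
    have h1 := h (Sum.inl ⟨2 * k + 1, by omega⟩)
    rw [cat_sum_inl] at h1
    have : ext0 u (2 * k + 1) = u (Sum.inl ⟨2 * k + 1, by omega⟩) := dif_pos _
    rw [this, ← h1, Finset.sum_eq_single ⟨k, hk⟩]
    · simp
    · intro m _ hm
      rw [if_neg]
      intro h'
      apply hm
      ext
      simp only
      omega
    · simp
  have hrec : ∀ k (hk : k < n), l ^ 2 * ext0 u (2 * k + 1) =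
      ((r ⟨k, hk⟩ : ℝ) + 2) * ext0 u (2 * k + 1) + ext0 u (2 * k + 3)
        + (if k = 0 then 0 else ext0 u (2 * k - 1)) := by
    intro k hk
    have h1 := hod k hk
    have h2 := hev k hk.le
    have h3 := hev (k + 1) hk
    rw [if_neg (by omega), show 2 * (k + 1) = 2 * k + 2 by ring,
      show 2 * k + 2 - 1 = 2 * k + 1 by omega, show 2 * k + 2 + 1 = 2 * k + 3 by ring] at h3
    have h4 : l * ∑ p : Fin (r ⟨k, hk⟩), u (Sum.inr ⟨⟨k, hk⟩, p⟩)
        = r ⟨k, hk⟩ * ext0 u (2 * k + 1) := by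
      rw [Finset.mul_sum, Finset.sum_congr rfl fun p _ => hr ⟨k, hk⟩ p]
      simp
    rw [sq, mul_assoc, h1, mul_add, mul_add, h2, h3, h4]
    ring
  have hex : ∃ k, k < n ∧ ∀ m, m < n → |ext0 u (2 * m + 1)| ≤ |ext0 u (2 * k + 1)| := by
    obtain ⟨k, hk, hk'⟩ := Finset.exists_max_image (Finset.range n)
      (fun m => |ext0 u (2 * m + 1)|) ⟨0, by simp; omega⟩
    exact ⟨k, by simpa using hk, fun m hm => hk' m (by simpa using hm)⟩
  have hk := Nat.find_spec hex
  have hmin := fun m => Nat.find_min (H := hex) (m := m)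
  set k := Nat.find hex
  obtain ⟨hkn, hkm⟩ := hk
  have hpos : 0 < |ext0 u (2 * k + 1)| := by
    by_contra hc
    have hz : ∀ m, ext0 u (2 * m + 1) = 0 := by
      intro m
      by_cases hm : m < n
      · have := hkm m hm
        exact abs_nonpos_iff.mp (by linarith)
      · exact dif_neg (by omega)
    apply hu
    ext v
    rcases v with ⟨a, ha⟩ | ⟨m, p⟩
    · have ha' : ext0 u a = u (Sum.inl ⟨a, ha⟩) := dif_pos _
      rw [← ha']
      rcases Nat.even_or_odd' a with ⟨m, rfl | rfl⟩
      · have h1 := hev m (by omega)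
        rw [hz] at h1
        by_cases hm : m = 0
        · simpa [hm, hl] using h1
        · rw [if_neg hm, show 2 * m - 1 = 2 * (m - 1) + 1 by omega, hz] at h1
          simpa [hl] using h1
      · simpa using hz m
    · have := hr m p
      rw [hz] at this
      simpa [hl] using this
  have h1 := hrec k hkn
  have hn1 : |ext0 u (2 * k + 3)| ≤ |ext0 u (2 * k + 1)| := by
    by_cases hk1 : k + 1 < n
    · exact hkm (k + 1) hk1
    · have : ext0 u (2 * k + 3) = 0 := dif_neg (by omega)
      rw [this, abs_zero]
      exact hpos.le
  have hp1 : |if k = 0 then 0 else ext0 u (2 * k - 1)| < |ext0 u (2 * k + 1)| := by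
    split_ifs with hk0
    · simpa using hpos
    · have := hmin (k - 1) (by omega)
      push Not at this
      obtain ⟨m, hm, hm'⟩ := this (by omega)
      rw [show 2 * k - 1 = 2 * (k - 1) + 1 by omega]
      exact hm'.trans_le (hkm m hm)
  have hrs : (r ⟨k, hkn⟩ : ℝ) ≤ s := by exact_mod_cast hmax _
  have h5 : (l ^ 2 - (r ⟨k, hkn⟩ + 2)) * |ext0 u (2 * k + 1)| < 2 * |ext0 u (2 * k + 1)| := by
    calc _ ≤ |l ^ 2 - (r ⟨k, hkn⟩ + 2)| * |ext0 u (2 * k + 1)| := by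
          gcongr
          exact le_abs_self _
      _ = |ext0 u (2 * k + 3) + (if k = 0 then 0 else ext0 u (2 * k - 1))| := by
          rw [← abs_mul]
          congr 1
          linarith
      _ ≤ _ := abs_add_le _ _
      _ < _ := by linarith
  have := lt_of_mul_lt_mul_right h5 hpos.le
  linarith

/-- Vector on the caterpillar with path values `f` and constant pendant values `g`. -/
def tv {n : ℕ} (r : Fin n → ℕ) (f : ℕ → ℝ) (g : Fin n → ℝ) :
    (Fin (2 * n + 1) ⊕ (Σ i : Fin n, Fin (r i))) → ℝ
  | Sum.inl a => f a
  | Sum.inr p => g p.1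

lemma tv_norm {n : ℕ} (r : Fin n → ℕ) (f : ℕ → ℝ) (g : Fin n → ℝ) :
    ∑ v, tv r f g v ^ 2 = ∑ a ∈ Finset.range (2 * n + 1), f a ^ 2 + ∑ k, r k * g k ^ 2 := by
  rw [Fintype.sum_sum_type, Fintype.sum_sigma, Finset.sum_range]
  simp [tv]

lemma tv_quad {n : ℕ} (r : Fin n → ℕ) (f : ℕ → ℝ) (g : Fin n → ℝ) :
    ∑ v, tv r f g v * ∑ w, (if (caterpillar n r).Adj v w then tv r f g w else 0)
      = 2 * (∑ a ∈ Finset.range (2 * n), f a * f (a + 1)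
        + ∑ k : Fin n, r k * f (2 * k + 1) * g k) := by
  have hext : ∀ m, ext0 (tv r f g) m = if m < 2 * n + 1 then f m else 0 := by
    intro m
    unfold ext0
    split_ifs <;> simp [tv]
  have h1 : ∀ a : Fin (2 * n + 1), tv r f g (Sum.inl a) *
      ∑ w, (if (caterpillar n r).Adj (Sum.inl a) w then tv r f g w else 0)
      = f a * ((if (a : ℕ) + 1 < 2 * n + 1 then f (a + 1) else 0)
        + (if (a : ℕ) = 0 then 0 else f (a - 1))) +
        ∑ k : Fin n, if (a : ℕ) = 2 * (k : ℕ) + 1 then r k * f (2 * k + 1) * g k else 0 := by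
    rintro ⟨a, ha⟩
    rw [cat_sum_inl, hext, hext, if_pos (show a - 1 < 2 * n + 1 by omega), mul_add, Finset.mul_sum]
    congr 1
    refine Finset.sum_congr rfl fun k _ => ?_
    simp only [tv]
    split_ifs with h
    · simp [h]; ring
    · simp
  have h2 : ∀ p : (Σ i : Fin n, Fin (r i)), tv r f g (Sum.inr p) *
      ∑ w, (if (caterpillar n r).Adj (Sum.inr p) w then tv r f g w else 0)
      = g p.1 * f (2 * p.1 + 1) := by
    rintro ⟨k, p⟩
    rw [cat_sum_inr, hext, if_pos (by omega)]
    rfl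
  rw [Fintype.sum_sum_type, Finset.sum_congr rfl fun a _ => h1 a,
    Finset.sum_congr rfl fun p _ => h2 p, Finset.sum_add_distrib, Fintype.sum_sigma,
    Finset.sum_comm]
  have h3 : ∀ k : Fin n, ∑ a : Fin (2 * n + 1),
      (if (a : ℕ) = 2 * (k : ℕ) + 1 then r k * f (2 * k + 1) * g k else 0)
      = r k * f (2 * k + 1) * g k := by
    intro k
    rw [sum_fin_eq (fun _ => (r k * f (2 * k + 1) * g k : ℝ)), dif_pos (by omega)]
  have h4 : ∀ k : Fin n, ∑ p : Fin (r k), g k * f (2 * k + 1) = r k * f (2 * k + 1) * g k := by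
    intro k
    simp; ring
  rw [Finset.sum_congr rfl fun k _ => h3 k]
  simp only [h4]
  simp only [mul_add, Finset.sum_add_distrib]
  rw [← Finset.sum_range (fun a => f a * if a + 1 < 2 * n + 1 then f (a + 1) else 0),
    ← Finset.sum_range (fun a => f a * if a = 0 then 0 else f (a - 1)),
    Finset.sum_range_succ, Finset.sum_range_succ' (fun a => f a * if a = 0 then 0 else f (a - 1))]
  have h5 : ∑ a ∈ Finset.range (2 * n), (f a * if a + 1 < 2 * n + 1 then f (a + 1) else 0)
      = ∑ a ∈ Finset.range (2 * n), f a * f (a + 1) := by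
    refine Finset.sum_congr rfl fun a ha => ?_
    rw [Finset.mem_range] at ha
    rw [if_pos (by omega)]
  rw [h5]
  simp only [Nat.add_sub_cancel, Nat.add_eq_zero_iff, one_ne_zero, and_false, if_false, if_true,
    lt_irrefl, mul_zero, add_zero]
  rw [show ∑ a ∈ Finset.range (2 * n), f (a + 1) * f a = ∑ a ∈ Finset.range (2 * n), f a * f (a + 1)
    from Finset.sum_congr rfl fun a _ => mul_comm _ _]
  ring

lemma lower1 {n : ℕ} (hn : 2 ≤ n) {r : Fin n → ℕ} (i : Fin n) (l : ℝ)
    (h : ∀ x : _ → ℝ, ∑ v, x v * ∑ w, (if (caterpillar n r).Adj v w then x w else 0) ≤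
        l * ∑ v, x v ^ 2) : (r i : ℝ) + 2 < l ^ 2 := by
  obtain ⟨m, q, hmq, hm, hq⟩ : ∃ m q : ℕ, (m = 2 * i + 3 ∧ q = 2 * i + 2 ∨
      m + 1 = 2 * i ∧ q = m) ∧ m < 2 * n + 1 ∧ q < 2 * n := by
    have := i.2
    by_cases h0 : (i : ℕ) = 0
    · exact ⟨2 * i + 3, 2 * i + 2, Or.inl ⟨rfl, rfl⟩, by omega, by omega⟩
    · exact ⟨2 * i - 1, 2 * i - 1, Or.inr ⟨by omega, rfl⟩, by omega, by omega⟩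
  have hi := i.2
  set c : ℝ := √((r i : ℝ) + 2) with hc
  have hc2 : c ^ 2 = r i + 2 := Real.sq_sqrt (by positivity)
  have hc0 : 0 < c := Real.sqrt_pos.mpr (by positivity)
  set f : ℕ → ℝ := fun a => if a = 2 * i + 1 then c else if a = 2 * i then 1 else
    if a = 2 * i + 2 then 1 else if a = m then c⁻¹ else 0 with hf
  set g : Fin n → ℝ := fun k => if k = i then 1 else 0 with hg
  have h1 := h (tv r f g)
  rw [tv_norm, tv_quad] at h1
  have hf2 : ∀ a, f a ^ 2 = (if a = 2 * i + 1 then c ^ 2 else 0) + (if a = 2 * i then 1 else 0) +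
    (if a = 2 * i + 2 then 1 else 0) + (if a = m then c⁻¹ ^ 2 else 0) := by
    intro a
    simp only [hf]
    split_ifs <;> first | omega | simp
  have hff : ∀ a, f a * f (a + 1) = (if a = 2 * i then c else 0) + (if a = 2 * i + 1 then c else 0)
      + (if a = q then c⁻¹ else 0) := by
    intro a
    simp only [hf]
    split_ifs <;> first | omega | simp
  have hN : ∑ a ∈ Finset.range (2 * n + 1), f a ^ 2 = c ^ 2 + 1 + 1 + c⁻¹ ^ 2 := by
    simp only [hf2, Finset.sum_add_distrib, Finset.sum_ite_eq', Finset.mem_range]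
    rw [if_pos (by omega), if_pos (by omega), if_pos (by omega), if_pos hm]
  have hS : ∑ a ∈ Finset.range (2 * n), f a * f (a + 1) = c + c + c⁻¹ := by
    simp only [hff, Finset.sum_add_distrib, Finset.sum_ite_eq', Finset.mem_range]
    rw [if_pos (by omega), if_pos (by omega), if_pos hq]
  have hg1 : ∑ k, (r k : ℝ) * g k ^ 2 = r i := by
    simp [hg]
  have hg2 : ∑ k : Fin n, (r k : ℝ) * f (2 * k + 1) * g k = r i * c := by
    simp [hg, hf]
  rw [hN, hS, hg1, hg2] at h1
  have hlc : c < l := by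
    by_contra hlc
    push Not at hlc
    have h6 : l * (c ^ 2 + 1 + 1 + c⁻¹ ^ 2 + r i) ≤ c * (c ^ 2 + 1 + 1 + c⁻¹ ^ 2 + r i) := by
      gcongr
    have h7 : (r i : ℝ) = c ^ 2 - 2 := by linarith
    rw [h7] at h1 h6
    have h8 : c * c⁻¹ ^ 2 = c⁻¹ := by field_simp
    have h9 : 0 < c⁻¹ := by positivity
    nlinarith
  rw [← hc2]
  gcongr

lemma lower2 {n : ℕ} {r : Fin n → ℕ} (i j : Fin n) (hij : i ≠ j) (hts : r j ≤ r i) (l : ℝ)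
    (u : (Fin (2 * n + 1) ⊕ (Σ i : Fin n, Fin (r i))) → ℝ)
    (h : ∀ x : _ → ℝ, ∑ v, u v * x v = 0 →
      ∑ v, x v * ∑ w, (if (caterpillar n r).Adj v w then x w else 0) ≤
        l * ∑ v, x v ^ 2) : (r j : ℝ) ≤ l ^ 2 := by
  by_cases ht0 : r j = 0
  · rw [ht0]; simpa using sq_nonneg l
  have hij' : (i : ℕ) ≠ j := fun h => hij (Fin.ext h)
  have ht : (0 : ℝ) < r j := by exact_mod_cast Nat.pos_of_ne_zero ht0
  have hst : (r j : ℝ) ≤ r i := by exact_mod_cast hts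
  have hs : (0 : ℝ) < r i := by linarith
  set c : ℝ := √(r i : ℝ) with hc
  set d : ℝ := √(r j : ℝ) with hd
  have hc2 : c ^ 2 = r i := Real.sq_sqrt hs.le
  have hd2 : d ^ 2 = r j := Real.sq_sqrt ht.le
  have hd0 : 0 < d := Real.sqrt_pos.mpr ht
  have hdc : d ≤ c := Real.sqrt_le_sqrt hst
  let f : ℝ → ℝ → ℕ → ℝ := fun α β a => if a = 2 * i + 1 then α * c else
    if a = 2 * j + 1 then β * d else 0
  let g : ℝ → ℝ → Fin n → ℝ := fun α β k => if k = i then α else if k = j then β else 0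
  have hlin : ∀ α β v, tv r (f α β) (g α β) v =
      α * tv r (f 1 0) (g 1 0) v + β * tv r (f 0 1) (g 0 1) v := by
    intro α β v
    rcases v with a | p <;> simp only [tv, f, g] <;> split_ifs <;> simp
  set P := ∑ v, u v * tv r (f 1 0) (g 1 0) v
  set R := ∑ v, u v * tv r (f 0 1) (g 0 1) v
  have horth : ∀ α β, ∑ v, u v * tv r (f α β) (g α β) v = α * P + β * R := by
    intro α β
    simp only [P, R, Finset.mul_sum, ← Finset.sum_add_distrib]
    refine Finset.sum_congr rfl fun v _ => ?_
    rw [hlin]; ring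
  obtain ⟨α, β, hab, hab0⟩ : ∃ α β : ℝ, α * P + β * R = 0 ∧ (0 < α ^ 2 + β ^ 2) := by
    by_cases hP : P = 0
    · exact ⟨1, 0, by simp [hP], by norm_num⟩
    · exact ⟨R, -P, by ring, by have := sq_pos_of_ne_zero hP; have := sq_nonneg R; rw [neg_sq]; linarith⟩
  have h1 := h (tv r (f α β) (g α β)) (by rw [horth, hab])
  rw [tv_norm, tv_quad] at h1
  have hf2 : ∀ a, f α β a ^ 2 = (if a = 2 * i + 1 then (α * c) ^ 2 else 0) +
      (if a = 2 * j + 1 then (β * d) ^ 2 else 0) := by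
    intro a
    simp only [f]
    split_ifs <;> first | omega | simp
  have hN : ∑ a ∈ Finset.range (2 * n + 1), f α β a ^ 2 = (α * c) ^ 2 + (β * d) ^ 2 := by
    simp only [hf2, Finset.sum_add_distrib, Finset.sum_ite_eq', Finset.mem_range]
    rw [if_pos (by omega), if_pos (by omega)]
  have hS : ∑ a ∈ Finset.range (2 * n), f α β a * f α β (a + 1) = 0 := by
    refine Finset.sum_eq_zero fun a _ => ?_
    simp only [f]
    split_ifs <;> first | omega | simp
  have hg1 : ∑ k, (r k : ℝ) * g α β k ^ 2 = r i * α ^ 2 + r j * β ^ 2 := by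
    have : ∀ k, (r k : ℝ) * g α β k ^ 2 = (if k = i then r i * α ^ 2 else 0)
        + (if k = j then r j * β ^ 2 else 0) := by
      intro k
      by_cases hk1 : k = i
      · subst hk1
        simp [g, hij]
      · by_cases hk2 : k = j
        · subst hk2
          simp [g, hk1]
        · simp [g, hk1, hk2]
    simp [this, Finset.sum_add_distrib]
  have hg2 : ∑ k : Fin n, (r k : ℝ) * f α β (2 * k + 1) * g α β k
      = r i * (α * c) * α + r j * (β * d) * β := by
    have : ∀ k : Fin n, (r k : ℝ) * f α β (2 * k + 1) * g α β k
        = (if k = i then r i * (α * c) * α else 0) + (if k = j then r j * (β * d) * β else 0) := by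
      intro k
      by_cases hk1 : k = i
      · subst hk1
        simp [f, g, hij]
      · by_cases hk2 : k = j
        · subst hk2
          simp [f, g, hk1, hij'.symm]
        · simp [g, hk1, hk2]
    simp [this, Finset.sum_add_distrib]
  rw [hN, hS, hg1, hg2] at h1
  have hdl : d ≤ l := by
    by_contra hlc
    push Not at hlc
    have hK : 0 < r i * α ^ 2 + r j * β ^ 2 := by
      nlinarith [mul_nonneg (sub_nonneg.mpr hst) (sq_nonneg α), mul_pos ht hab0]
    have h6 : 2 * (r i * α ^ 2 * c + r j * β ^ 2 * d) ≤ l * (2 * (r i * α ^ 2 + r j * β ^ 2)) := by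
      have e1 : (α * c) ^ 2 = r i * α ^ 2 := by rw [← hc2]; ring
      have e2 : (β * d) ^ 2 = r j * β ^ 2 := by rw [← hd2]; ring
      rw [e1, e2] at h1
      linarith
    have h7 : r i * α ^ 2 * d ≤ r i * α ^ 2 * c := by gcongr
    have h8 := mul_lt_mul_of_pos_right hlc hK
    linarith
  rw [← hd2]
  gcongr

theorem stmt12 (n : ℕ) (hn : 2 ≤ n) (r : Fin n → ℕ) (s t : ℕ) (i j : Fin n) (hij : i ≠ j)
    (hs : r i = s) (ht : r j = t) (hts : t ≤ s)
    (hmax : ∀ k, r k ≤ s) (hsec : ∀ k, k ≠ i → r k ≤ t) :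
    (s : ℝ) + 2 < ((eigsDesc (caterpillar n r)).getD 0 0) ^ 2 ∧
    ((eigsDesc (caterpillar n r)).getD 0 0) ^ 2 < (s : ℝ) + 4 ∧
    (t : ℝ) ≤ ((eigsDesc (caterpillar n r)).getD 1 0) ^ 2 := by
  obtain ⟨u, hu0, hu, h1, h2⟩ := spec (caterpillar n r) (by
    simp only [Fintype.card_sum, Fintype.card_fin]; omega)
  subst hs ht
  exact ⟨lower1 hn i _ h1, upper hn hmax u hu0 _ hu, lower2 i j hij hts _ u h2⟩
end
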